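/- Let μ ∈ P₂ with complex first moment m₁(μ) = a + bi (b ≥ 0). Then the N-fold Boolean convolution power of D_{1/N}μ converges weakly to the Cauchy distribution μ_{a,b} as N → ∞; equivalently F_μ(Nz) - (N-1)z → z - m₁(μ) for z in the lower half-plane. -/

import Mathlib

open MeasureTheory Complex

/-- Condition (A2): the density `p` has the form `p x = ∑ₙ aₙ/xⁿ` (with `a₀ = a₁ = 0`),
absolutely convergent for `|x| > r`, and `p` is nonnegative on `|x| ≥ R`. -/
structure A2 (p : ℝ → ℝ) (a : ℕ → ℝ) (r R : ℝ) : Prop where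
  hr : 0 < r
  hrR : r < R
  ha0 : a 0 = 0
  ha1 : a 1 = 0
  hsum : ∀ x : ℝ, r < |x| → HasSum (fun n => a n / x ^ n) (p x)
  habs : ∀ x : ℝ, r < |x| → Summable (fun n => |a n| / |x| ^ n)
  hpos : ∀ x : ℝ, R ≤ |x| → 0 ≤ p x

/-- The measure `λ(dx) = p(x) 1_{|x| ≥ R} dx`. -/
noncomputable def tailMeasure (p : ℝ → ℝ) (R : ℝ) : Measure ℝ :=
  volume.withDensity (fun x => ENNReal.ofReal (if R ≤ |x| then p x else 0))

/-- The complex extension `p(z) = ∑ₙ aₙ/zⁿ` of the density. -/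
noncomputable def pC (a : ℕ → ℝ) (z : ℂ) : ℂ := ∑' n : ℕ, (a n : ℂ) / z ^ n

/-- The complex extension of `u ↦ p(1/u)`, i.e. `∑ₙ aₙ uⁿ`. -/
noncomputable def pCInv (a : ℕ → ℝ) (u : ℂ) : ℂ := ∑' n : ℕ, (a n : ℂ) * u ^ n

/-- Contour integral over the circular arc of radius `c` centred at `0`,
with angle running from `θ₁` to `θ₂`. -/
noncomputable def arcInt (θ₁ θ₂ c : ℝ) (f : ℂ → ℂ) : ℂ :=
  ∫ θ in θ₁..θ₂, (Complex.I * c * Complex.exp (θ * Complex.I)) *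
    f (c * Complex.exp (θ * Complex.I))

/-- The Stieltjes transform of a measure on `ℝ`. -/
noncomputable def stieltjes (μ : Measure ℝ) (z : ℂ) : ℂ :=
  ∫ x, (z - x)⁻¹ ∂μ

/-- The Cauchy distribution with location `a` and scale `b`. -/
noncomputable def cauchyMeasure (a b : ℝ) : Measure ℝ :=
  volume.withDensity (fun x => ENNReal.ofReal ((1 / Real.pi) * b / ((x - a) ^ 2 + b ^ 2)))

open scoped Classical in
/-- The Cauchy distribution `μ_{a,b}`, interpreted as `δ_a` when `b = 0`. -/
noncomputable def cauchyOrDirac (a b : ℝ) : Measure ℝ :=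
  if b = 0 then Measure.dirac a else cauchyMeasure a b

open Filter Topology Set
open ProbabilityTheory (cauchyPDFReal cauchyPDFReal_def measurable_cauchyPDFReal
  integrable_cauchyPDFReal integral_cauchyPDFReal_eq_one cauchyPDF_pos)
open scoped NNReal

/-- The norm of a resolvent off the real line is at most the inverse distance to the line. -/
lemma norm_inv_sub_ofReal_le {z : ℂ} (hz : z.im ≠ 0) (x : ℝ) : ‖(z - x)⁻¹‖ ≤ |z.im|⁻¹ := by
  rw [norm_inv]
  have h := Complex.abs_im_le_norm (z - x)
  simp only [sub_im, ofReal_im, sub_zero] at h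
  exact inv_anti₀ (abs_pos.mpr hz) h

lemma sub_ofReal_ne_zero {z : ℂ} (hz : z.im ≠ 0) (x : ℝ) : z - x ≠ 0 := fun h => hz (by
  simpa using congrArg Complex.im h)

lemma integrable_inv_sub_ofReal (ρ : Measure ℝ) [IsFiniteMeasure ρ] {z : ℂ} (hz : z.im ≠ 0) :
    Integrable (fun x : ℝ => (z - x)⁻¹) ρ :=
  .of_bound (by fun_prop) |z.im|⁻¹ (.of_forall (norm_inv_sub_ofReal_le hz))

lemma im_inv_sub_ofReal (ε : ℝ≥0) (t x : ℝ) :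
    ((t - ε * Complex.I - x : ℂ)⁻¹).im = Real.pi * cauchyPDFReal x ε t := by
  have hπ := Real.pi_ne_zero
  rw [cauchyPDFReal_def, Complex.inv_im, Complex.normSq_apply]
  simp
  field_simp

/-- The Poisson smoothing of a finite measure is read off from its Stieltjes transform. -/
lemma integral_cauchyPDFReal_eq_stieltjes (ρ : Measure ℝ) [IsFiniteMeasure ρ] {ε : ℝ≥0}
    (hε : 0 < ε) (t : ℝ) :
    ∫ x, cauchyPDFReal x ε t ∂ρ = Real.pi⁻¹ * (stieltjes ρ (t - ε * Complex.I)).im := by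
  have hz : (t - ε * Complex.I : ℂ).im ≠ 0 := by simpa using hε.ne'
  have h := integral_im (integrable_inv_sub_ofReal ρ hz)
  rw [stieltjes]
  change _ = _ * RCLike.im (∫ x : ℝ, ((t - ε * Complex.I : ℂ) - x)⁻¹ ∂ρ)
  rw [← h, ← integral_const_mul]
  refine integral_congr_ae (.of_forall fun x => ?_)
  change _ = Real.pi⁻¹ * ((t - ε * Complex.I - x : ℂ)⁻¹).im
  rw [im_inv_sub_ofReal]
  field_simp

lemma measurable_uncurry_cauchyPDFReal (ε : ℝ≥0) :
    Measurable (fun q : ℝ × ℝ => cauchyPDFReal q.1 ε q.2) := by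
  simp only [cauchyPDFReal_def]
  fun_prop

lemma integrable_prod_cauchyPDFReal (ρ : Measure ℝ) [IsFiniteMeasure ρ] {ε : ℝ≥0} (hε : 0 < ε) :
    Integrable (fun q : ℝ × ℝ => cauchyPDFReal q.1 ε q.2) (ρ.prod volume) := by
  rw [integrable_prod_iff (measurable_uncurry_cauchyPDFReal ε).aestronglyMeasurable]
  refine ⟨.of_forall fun x => integrable_cauchyPDFReal x, ?_⟩
  have (x : ℝ) : ∫ t, ‖cauchyPDFReal x ε t‖ = 1 := by
    simp_rw [Real.norm_of_nonneg (cauchyPDF_pos x hε.ne' _).le]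
    exact integral_cauchyPDFReal_eq_one x hε.ne'
  simp only [this]
  exact integrable_const _

lemma integrable_integral_cauchyPDFReal (ρ : Measure ℝ) [IsFiniteMeasure ρ] {ε : ℝ≥0}
    (hε : 0 < ε) : Integrable (fun t => ∫ x, cauchyPDFReal x ε t ∂ρ) :=
  (integrable_prod_cauchyPDFReal ρ hε).integral_prod_right

lemma integral_integral_mul_cauchyPDFReal (ρ : Measure ℝ) [IsFiniteMeasure ρ] {ε : ℝ≥0}
    (hε : 0 < ε) {f : ℝ → ℝ} (hf : Measurable f) {M : ℝ} (hM : ∀ x, |f x| ≤ M) :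
    ∫ x, (∫ t, f t * cauchyPDFReal x ε t) ∂ρ = ∫ t, f t * ∫ x, cauchyPDFReal x ε t ∂ρ := by
  simp_rw [← integral_const_mul]
  refine integral_integral_swap ?_
  exact (integrable_prod_cauchyPDFReal ρ hε).bdd_mul (c := M)
    (hf.comp measurable_snd).aestronglyMeasurable (.of_forall fun q => hM q.2)

/-- Scheffé's lemma, tested against a bounded function. -/
lemma tendsto_integral_mul_of_tendsto_density {α : Type*} [MeasurableSpace α] {m : Measure α}
    {h : ℕ → α → ℝ} {g f : α → ℝ} (hh : ∀ n, Integrable (h n) m) (hg : Integrable g m)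
    (hh0 : ∀ n x, 0 ≤ h n x) (hg0 : ∀ x, 0 ≤ g x)
    (hmass : ∀ n, ∫ x, h n x ∂m = ∫ x, g x ∂m)
    (hlim : ∀ x, Tendsto (fun n => h n x) atTop (𝓝 (g x)))
    (hf : Measurable f) {M : ℝ} (hM : ∀ x, |f x| ≤ M) :
    Tendsto (fun n => ∫ x, f x * h n x ∂m) atTop (𝓝 (∫ x, f x * g x ∂m)) := by
  have hpos : Tendsto (fun n => ∫ x, max (g x - h n x) 0 ∂m) atTop (𝓝 0) := by
    have h0 := tendsto_integral_of_dominated_convergence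
      (F := fun n x => max (g x - h n x) 0) (f := fun _ => 0) g
      (fun n => ((hg.sub (hh n)).pos_part).aestronglyMeasurable) hg (fun n => .of_forall fun x => by
        rw [Real.norm_of_nonneg (le_max_right _ _)]
        exact max_le (by linarith [hh0 n x]) (hg0 x))
      (.of_forall fun x => by
        simpa using ((hlim x).const_sub (g x)).max (tendsto_const_nhds (x := (0 : ℝ))))
    simpa using h0
  have hL1 (n : ℕ) : ∫ x, |h n x - g x| ∂m = 2 * ∫ x, max (g x - h n x) 0 ∂m := by
    have e (x : α) : |h n x - g x| = 2 * max (g x - h n x) 0 + (h n x - g x) := by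
      rcases le_total (g x) (h n x) with H | H
      · rw [abs_of_nonneg (by linarith), max_eq_right (by linarith)]; ring
      · rw [abs_of_nonpos (by linarith), max_eq_left (by linarith)]; ring
    simp_rw [e]
    have i1 : Integrable (fun x => 2 * max (g x - h n x) 0) m :=
      ((hg.sub (hh n)).pos_part).const_mul 2
    have i2 : Integrable (fun x => h n x - g x) m := (hh n).sub hg
    rw [integral_add i1 i2, integral_const_mul, integral_sub (hh n) hg, hmass n, sub_self, add_zero]
  rw [tendsto_iff_norm_sub_tendsto_zero]
  refine squeeze_zero (fun _ => norm_nonneg _) (fun n => ?_)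
    (g := fun n => M * (2 * ∫ x, max (g x - h n x) 0 ∂m)) (by simpa using (hpos.const_mul 2).const_mul M)
  have i1 : Integrable (fun x => f x * h n x) m :=
    (hh n).bdd_mul (c := M) (by fun_prop) (.of_forall hM)
  have i2 : Integrable (fun x => f x * g x) m :=
    hg.bdd_mul (c := M) (by fun_prop) (.of_forall hM)
  rw [← integral_sub i1 i2, ← hL1, ← integral_const_mul]
  refine norm_integral_le_of_norm_le (((hh n).sub hg).abs.const_mul M) (.of_forall fun x => ?_)
  rw [← mul_sub, Real.norm_eq_abs, abs_mul]
  exact mul_le_mul_of_nonneg_right (hM x) (abs_nonneg _)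

lemma integral_mul_cauchyPDFReal_eq {ε : ℝ≥0} (hε : 0 < ε) (f : ℝ → ℝ) (x : ℝ) :
    ∫ t, f t * cauchyPDFReal x ε t =
      ∫ s, f (x + ε * s) * (Real.pi⁻¹ * (1 + s ^ 2)⁻¹) := by
  have h1 := integral_add_left_eq_self (μ := volume) (fun t => f t * cauchyPDFReal x ε t) x
  have h2 := Measure.integral_comp_mul_left (fun t => f (x + t) * cauchyPDFReal x ε (x + t)) (ε : ℝ)
  have hε' : (0 : ℝ) < ε := hε
  rw [h1, abs_of_pos (by positivity), smul_eq_mul, eq_inv_mul_iff_mul_eq₀ hε'.ne'] at h2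
  rw [← h2, ← integral_const_mul]
  refine integral_congr_ae (.of_forall fun s => ?_)
  simp only [cauchyPDFReal_def]
  have : (0 : ℝ) < 1 + s ^ 2 := by positivity
  have h3 : (x + ε * s - x) ^ 2 + (ε : ℝ) ^ 2 = ε ^ 2 * (1 + s ^ 2) := by ring
  rw [h3]
  field_simp

/-- Poisson smoothing approximates bounded Lipschitz functions uniformly. -/
lemma exists_integral_mul_cauchyPDFReal_close {f : ℝ → ℝ} {L : ℝ≥0} (hL : LipschitzWith L f)
    {M : ℝ} (hM : ∀ x, |f x| ≤ M) {δ : ℝ} (hδ : 0 < δ) :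
    ∃ ε : ℝ≥0, 0 < ε ∧ ∀ x, |(∫ t, f t * cauchyPDFReal x ε t) - f x| ≤ δ := by
  have hP : Integrable (fun s : ℝ => Real.pi⁻¹ * (1 + s ^ 2)⁻¹) :=
    integrable_inv_one_add_sq.const_mul _
  have hP1 : ∫ s : ℝ, Real.pi⁻¹ * (1 + s ^ 2)⁻¹ = 1 := by
    rw [integral_const_mul, integral_univ_inv_one_add_sq, inv_mul_cancel₀ Real.pi_ne_zero]
  have hP0 (s : ℝ) : 0 ≤ Real.pi⁻¹ * (1 + s ^ 2)⁻¹ := by positivity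
  have hM0 : 0 ≤ M := (abs_nonneg _).trans (hM 0)
  let η : ℕ → ℝ → ℝ := fun n s =>
    min (L * (1 / ((n : ℝ) + 1) * |s|)) (2 * M) * (Real.pi⁻¹ * (1 + s ^ 2)⁻¹)
  have hη0 (n : ℕ) (s : ℝ) : 0 ≤ min (L * (1 / ((n : ℝ) + 1) * |s|)) (2 * M) :=
    le_min (by positivity) (by positivity)
  have hηb (n : ℕ) (s : ℝ) : ‖min (L * (1 / ((n : ℝ) + 1) * |s|)) (2 * M)‖ ≤ 2 * M := by
    rw [Real.norm_of_nonneg (hη0 n s)]; exact min_le_right _ _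
  have hηi (n : ℕ) : Integrable (η n) := hP.bdd_mul (c := 2 * M)
    (Continuous.aestronglyMeasurable (by fun_prop)) (.of_forall (hηb n))
  have hlim : Tendsto (fun n => ∫ s, η n s) atTop (𝓝 0) := by
    rw [← integral_zero ℝ ℝ (μ := volume)]
    refine tendsto_integral_of_dominated_convergence
      (fun s => 2 * M * (Real.pi⁻¹ * (1 + s ^ 2)⁻¹)) (fun n => (hηi n).aestronglyMeasurable)
      (hP.const_mul _) (fun n => .of_forall fun s => ?_) (.of_forall fun s => ?_)
    · rw [norm_mul, Real.norm_of_nonneg (hP0 s)]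
      exact mul_le_mul_of_nonneg_right (hηb n s) (hP0 s)
    · have h0 := tendsto_one_div_add_atTop_nhds_zero_nat (𝕜 := ℝ)
      have h1 := ((((h0.mul_const |s|).const_mul (L : ℝ)).min
        (tendsto_const_nhds (x := 2 * M))).mul_const (Real.pi⁻¹ * (1 + s ^ 2)⁻¹))
      simpa [hM0, η] using h1
  obtain ⟨n, hn⟩ := (hlim.eventually_lt_const hδ).exists
  have hε : (0 : ℝ) < 1 / ((n : ℝ) + 1) := by positivity
  refine ⟨(1 / ((n : ℝ) + 1)).toNNReal, Real.toNNReal_pos.mpr hε, fun x => ?_⟩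
  rw [integral_mul_cauchyPDFReal_eq (Real.toNNReal_pos.mpr hε), Real.coe_toNNReal _ hε.le]
  have i1 : Integrable (fun s : ℝ => f (x + 1 / ((n : ℝ) + 1) * s) * (Real.pi⁻¹ * (1 + s ^ 2)⁻¹)) :=
    hP.bdd_mul (c := M) (hL.continuous.comp (by fun_prop)).aestronglyMeasurable
      (.of_forall fun s => hM _)
  have e : f x = ∫ s : ℝ, f x * (Real.pi⁻¹ * (1 + s ^ 2)⁻¹) := by
    rw [integral_const_mul, hP1, mul_one]
  rw [e, ← integral_sub i1 (hP.const_mul _)]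
  refine le_trans ?_ hn.le
  rw [← Real.norm_eq_abs]
  refine norm_integral_le_of_norm_le (hηi n) (.of_forall fun s => ?_)
  rw [← sub_mul, norm_mul, Real.norm_of_nonneg (hP0 s)]
  refine mul_le_mul_of_nonneg_right (le_min ?_ ?_) (hP0 s)
  · have := hL.dist_le_mul (x + 1 / ((n : ℝ) + 1) * s) x
    rw [Real.dist_eq, Real.dist_eq, add_sub_cancel_left, abs_mul, abs_of_pos hε] at this
    exact this
  · rw [Real.norm_eq_abs, abs_le]
    have h1 := abs_le.mp (hM (x + 1 / ((n : ℝ) + 1) * s))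
    have h2 := abs_le.mp (hM x)
    constructor <;> linarith

/-- Pointwise convergence of Stieltjes transforms on the lower half-plane to that of a probability
measure implies weak convergence. -/
theorem tendsto_of_tendsto_stieltjes {μs : ℕ → ProbabilityMeasure ℝ} {μ : ProbabilityMeasure ℝ}
    (h : ∀ z : ℂ, z.im < 0 →
      Tendsto (fun n => stieltjes (μs n) z) atTop (𝓝 (stieltjes μ z))) :
    Tendsto μs atTop (𝓝 μ) := by
  rw [tendsto_iff_forall_lipschitz_integral_tendsto]
  rintro f ⟨C, hC⟩ ⟨L, hL⟩
  have hM (x : ℝ) : |f x| ≤ |f 0| + C := by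
    have h1 := hC x 0
    rw [Real.dist_eq] at h1
    have h2 := abs_sub_abs_le_abs_sub (f x) (f 0)
    linarith
  set M := |f 0| + C
  have hfm : Measurable f := hL.continuous.measurable
  have hfi (ρ : ProbabilityMeasure ℝ) : Integrable f (ρ : Measure ℝ) :=
    .of_bound hfm.aestronglyMeasurable M (.of_forall hM)
  have key (ε : ℝ≥0) (hε : 0 < ε) : Tendsto
      (fun n => ∫ x, (∫ t, f t * cauchyPDFReal x ε t) ∂(μs n : Measure ℝ)) atTop
      (𝓝 (∫ x, (∫ t, f t * cauchyPDFReal x ε t) ∂(μ : Measure ℝ))) := by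
    simp_rw [integral_integral_mul_cauchyPDFReal _ hε hfm hM]
    have mass (ρ : ProbabilityMeasure ℝ) :
        ∫ t, (∫ x, cauchyPDFReal x ε t ∂(ρ : Measure ℝ)) = 1 := by
      have h1 := integral_integral_mul_cauchyPDFReal (ρ : Measure ℝ) hε (f := fun _ => 1)
        measurable_const (M := 1) (by simp)
      simp only [one_mul, integral_cauchyPDFReal_eq_one _ hε.ne'] at h1
      rw [← h1]; simp
    refine tendsto_integral_mul_of_tendsto_density
      (fun n => integrable_integral_cauchyPDFReal _ hε) (integrable_integral_cauchyPDFReal _ hε)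
      (fun n t => integral_nonneg fun x => (cauchyPDF_pos x hε.ne' t).le)
      (fun t => integral_nonneg fun x => (cauchyPDF_pos x hε.ne' t).le)
      (fun n => by rw [mass, mass]) (fun t => ?_) hfm hM
    simp_rw [integral_cauchyPDFReal_eq_stieltjes _ hε]
    exact ((Complex.continuous_im.tendsto _).comp
      (h (t - ε * Complex.I) (by simpa using hε))).const_mul _
  rw [Metric.tendsto_atTop]
  intro δ hδ
  obtain ⟨ε, hε, hclose⟩ := exists_integral_mul_cauchyPDFReal_close hL hM (δ := δ / 4) (by linarith)
  have hsi (ρ : ProbabilityMeasure ℝ) :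
      Integrable (fun x => ∫ t, f t * cauchyPDFReal x ε t) (ρ : Measure ℝ) :=
    ((integrable_prod_cauchyPDFReal (ρ : Measure ℝ) hε).bdd_mul (c := M)
      (f := fun q : ℝ × ℝ => f q.2) (hfm.comp measurable_snd).aestronglyMeasurable (.of_forall fun q => hM q.2)).integral_prod_left
  have happrox (ρ : ProbabilityMeasure ℝ) :
      |(∫ x, (∫ t, f t * cauchyPDFReal x ε t) ∂(ρ : Measure ℝ)) - ∫ x, f x ∂(ρ : Measure ℝ)|
        ≤ δ / 4 := by
    rw [← integral_sub (hsi ρ) (hfi ρ)]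
    simpa using norm_integral_le_of_norm_le_const (μ := (ρ : Measure ℝ))
      (f := fun x => (∫ t, f t * cauchyPDFReal x ε t) - f x) (.of_forall hclose)
  obtain ⟨n₀, hn₀⟩ := (Metric.tendsto_atTop.mp (key ε hε)) (δ / 4) (by linarith)
  refine ⟨n₀, fun n hn => ?_⟩
  have h1 := abs_le.mp (happrox (μs n))
  have h2 := abs_le.mp (happrox μ)
  have h3 := abs_lt.mp (Real.dist_eq _ _ ▸ hn₀ n hn)
  rw [Real.dist_eq, abs_lt]
  constructor <;> linarith

lemma integrable_norm_inv_ofReal_sub_sq {c : ℂ} (hc : c.im ≠ 0) :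
    Integrable (fun x : ℝ => ‖(x - c)⁻¹‖ ^ 2) := by
  have h := (integrable_cauchyPDFReal c.re (γ := ‖c.im‖₊)).const_mul (Real.pi * |c.im|⁻¹)
  refine h.congr (.of_forall fun x => ?_)
  have h1 : |c.im| ≠ 0 := abs_ne_zero.mpr hc
  simp only [cauchyPDFReal_def, norm_inv, inv_pow, ← Complex.normSq_eq_norm_sq,
    Complex.normSq_apply, coe_nnnorm, Real.norm_eq_abs, sq_abs]
  have h2 := Real.pi_ne_zero
  have : (x - c.re) ^ 2 + c.im ^ 2 ≠ 0 := by positivity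
  have h3 : (x - c.re) * (x - c.re) + c.im * c.im ≠ 0 := by convert this using 1; ring
  simp
  field_simp

lemma integrable_inv_mul_inv {c z : ℂ} (hc : c.im ≠ 0) (hz : z.im ≠ 0) :
    Integrable (fun x : ℝ => ((x - c) * (z - x))⁻¹) := by
  refine ((integrable_norm_inv_ofReal_sub_sq hc).add (integrable_norm_inv_ofReal_sub_sq hz)).mono'
    (by fun_prop) (.of_forall fun x => ?_)
  rw [mul_inv, norm_mul, ← neg_sub (x : ℂ) z, inv_neg, norm_neg]
  simp only [Pi.add_apply]
  nlinarith [sq_nonneg (‖(x - c : ℂ)⁻¹‖ - ‖(x - z : ℂ)⁻¹‖), sq_nonneg ‖(x - c : ℂ)⁻¹‖,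
    sq_nonneg ‖(x - z : ℂ)⁻¹‖]

lemma tendsto_log_ofReal_add_sub_log (c : ℂ) :
    Tendsto (fun x : ℝ => Complex.log (x + c) - Real.log x) atTop (𝓝 0) := by
  have h0 : Tendsto (fun x : ℝ => 1 + c * (x⁻¹ : ℝ)) atTop (𝓝 1) := by
    have := ((Complex.continuous_ofReal.tendsto 0).comp tendsto_inv_atTop_zero).const_mul c
    simpa using this.const_add 1
  have h1 := h0.clog Complex.one_mem_slitPlane
  rw [Complex.log_one] at h1
  refine h1.congr' ?_
  filter_upwards [eventually_gt_atTop 0, h0.eventually_ne one_ne_zero] with x hx hne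
  have hx' : (x : ℂ) ≠ 0 := by exact_mod_cast hx.ne'
  have e : (x : ℂ) + c = x * (1 + c * (x⁻¹ : ℝ)) := by
    push_cast
    field_simp
  rw [e, Complex.log_ofReal_mul hx hne]
  ring

lemma log_neg_of_im_pos {w : ℂ} (hw : 0 < w.im) :
    Complex.log (-w) = Complex.log w - Real.pi * Complex.I := by
  rw [Complex.log, Complex.log, norm_neg, Complex.arg_neg_eq_arg_sub_pi_of_im_pos hw]
  push_cast
  ring

lemma log_neg_of_im_neg {w : ℂ} (hw : w.im < 0) :
    Complex.log (-w) = Complex.log w + Real.pi * Complex.I := by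
  rw [Complex.log, Complex.log, norm_neg, Complex.arg_neg_eq_arg_add_pi_of_im_neg hw]
  push_cast
  ring

lemma tendsto_log_sub_log_atTop (c z : ℂ) :
    Tendsto (fun x : ℝ => Complex.log (x - c) - Complex.log (x - z)) atTop (𝓝 0) := by
  have h := (tendsto_log_ofReal_add_sub_log (-c)).sub (tendsto_log_ofReal_add_sub_log (-z))
  simpa [← sub_eq_add_neg] using h

lemma tendsto_log_sub_log_atBot_of_im_neg {c z : ℂ} (hc : c.im < 0) (hz : z.im < 0) :
    Tendsto (fun x : ℝ => Complex.log (x - c) - Complex.log (x - z)) atBot (𝓝 0) := by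
  have h := ((tendsto_log_ofReal_add_sub_log c).sub
    (tendsto_log_ofReal_add_sub_log z)).comp tendsto_neg_atBot_atTop
  rw [sub_zero] at h
  refine h.congr fun x => ?_
  have e (w : ℂ) : (x : ℂ) - w = -((-x : ℝ) + w) := by push_cast; ring
  simp only [Function.comp_apply, e]
  rw [log_neg_of_im_neg (by simpa), log_neg_of_im_neg (by simpa)]
  ring

lemma tendsto_log_sub_log_atBot {c z : ℂ} (hc : 0 < c.im) (hz : z.im < 0) :
    Tendsto (fun x : ℝ => Complex.log (x - c) - Complex.log (x - z)) atBot
      (𝓝 (-(2 * Real.pi * Complex.I))) := by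
  have h := (((tendsto_log_ofReal_add_sub_log c).sub
    (tendsto_log_ofReal_add_sub_log z)).comp tendsto_neg_atBot_atTop).sub_const
      (2 * Real.pi * Complex.I)
  rw [sub_zero, zero_sub] at h
  refine h.congr fun x => ?_
  have e (w : ℂ) : (x : ℂ) - w = -((-x : ℝ) + w) := by push_cast; ring
  simp only [Function.comp_apply, e]
  rw [log_neg_of_im_pos (by simpa), log_neg_of_im_neg (by simpa)]
  ring

lemma integral_inv_mul_inv_of_tendsto {c z l : ℂ} (hc : c.im ≠ 0) (hz : z.im ≠ 0)
    (hl : Tendsto (fun x : ℝ => Complex.log (x - c) - Complex.log (x - z)) atBot (𝓝 l)) :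
    (z - c) * ∫ x : ℝ, ((x - c) * (z - x))⁻¹ = -l := by
  have hmem {w : ℂ} (hw : w.im ≠ 0) (x : ℝ) : (x : ℂ) - w ∈ Complex.slitPlane :=
    .inr (by simpa using hw)
  have hd (x : ℝ) : HasDerivAt (fun x : ℝ => Complex.log (x - c) - Complex.log (x - z))
      ((z - c) * ((x - c) * (z - x))⁻¹) x := by
    have h (w : ℂ) (hw : w.im ≠ 0) :=
      (Complex.ofRealCLM.hasDerivAt (x := x).sub_const w).clog_real (hmem hw x)
    convert! (h c hc).sub (h z hz) using 1
    have h1 := Complex.slitPlane_ne_zero (hmem hc x)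
    have h2 := Complex.slitPlane_ne_zero (hmem hz x)
    have h3 := sub_ofReal_ne_zero hz x
    simp
    field_simp
    ring
  rw [← integral_const_mul, integral_of_hasDerivAt_of_tendsto hd
    ((integrable_inv_mul_inv hc hz).const_mul _) hl (tendsto_log_sub_log_atTop c z), zero_sub]

lemma integral_inv_mul_inv {c z : ℂ} (hc : 0 < c.im) (hz : z.im < 0) :
    (z - c) * ∫ x : ℝ, ((x - c) * (z - x))⁻¹ = 2 * Real.pi * Complex.I := by
  rw [integral_inv_mul_inv_of_tendsto hc.ne' hz.ne (tendsto_log_sub_log_atBot hc hz), neg_neg]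

lemma integral_inv_mul_inv_of_im_neg {c z : ℂ} (hc : c.im < 0) (hz : z.im < 0) :
    ∫ x : ℝ, ((x - c) * (z - x))⁻¹ = 0 := by
  rcases eq_or_ne z c with rfl | hne
  · have hlim {l : Filter ℝ} (hl : Tendsto (fun x : ℝ => ‖x‖) l atTop) :
        Tendsto (fun x : ℝ => ((x : ℂ) - z)⁻¹) l (𝓝 0) := by
      refine tendsto_inv₀_cobounded.comp (tendsto_norm_atTop_iff_cobounded.mp ?_)
      refine tendsto_atTop_mono (fun x => ?_) (tendsto_atTop_add_const_right l (-‖z‖) hl)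
      rw [← Complex.norm_real x, ← sub_eq_add_neg]
      exact norm_sub_norm_le _ _
    have hd (x : ℝ) : HasDerivAt (fun x : ℝ => ((x : ℂ) - z)⁻¹) (((x - z) * (z - x))⁻¹) x := by
      have h3 := sub_ofReal_ne_zero hz.ne x
      have h1 : (x : ℂ) - z ≠ 0 := by rw [← neg_sub]; exact neg_ne_zero.mpr h3
      convert! (Complex.ofRealCLM.hasDerivAt (x := x).sub_const z).inv h1 using 1
      simp
      field_simp
      ring
    rw [integral_of_hasDerivAt_of_tendsto hd (integrable_inv_mul_inv hc.ne hz.ne)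
      (hlim tendsto_abs_atBot_atTop) (hlim tendsto_norm_atTop_atTop), sub_zero]
  · have h := integral_inv_mul_inv_of_tendsto hc.ne hz.ne
      (tendsto_log_sub_log_atBot_of_im_neg hc hz)
    simpa [sub_ne_zero.mpr hne] using h

lemma cauchyOrDirac_eq (a b : ℝ) (hb : 0 ≤ b) :
    cauchyOrDirac a b = ProbabilityTheory.cauchyMeasure a b.toNNReal := by
  rw [cauchyOrDirac]
  split_ifs with h
  · simp [h]
  · have hb' : b.toNNReal ≠ 0 := by simpa using lt_of_le_of_ne hb (Ne.symm h)
    rw [ProbabilityTheory.cauchyMeasure_of_scale_ne_zero a hb', cauchyMeasure]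
    congr 1
    ext x
    rw [ProbabilityTheory.cauchyPDF_def, cauchyPDFReal_def, Real.coe_toNNReal _ hb, one_div,
      div_eq_mul_inv]

lemma stieltjes_dirac (a : ℝ) (z : ℂ) : stieltjes (Measure.dirac a) z = (z - a)⁻¹ := by
  rw [stieltjes, integral_dirac]

lemma stieltjes_cauchyMeasure (a : ℝ) {b : ℝ} (hb : 0 < b) {z : ℂ} (hz : z.im < 0) :
    stieltjes (cauchyMeasure a b) z = (z - (a + Complex.I * b))⁻¹ := by
  set c : ℂ := a + Complex.I * b with hc
  set c' : ℂ := a - Complex.I * b with hc'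
  have hcim : c.im = b := by simp [hc]
  have hcim' : c'.im = -b := by simp [hc']
  have hzc : z - c ≠ 0 := fun h => by
    have := congrArg Complex.im h
    rw [Complex.sub_im, hcim, Complex.zero_im] at this
    linarith
  have hdens (x : ℝ) : ((1 / Real.pi * b / ((x - a) ^ 2 + b ^ 2) : ℝ) : ℂ) * (z - x)⁻¹ =
      (2 * Real.pi * Complex.I)⁻¹ * (((x - c) * (z - x))⁻¹ - ((x - c') * (z - x))⁻¹) := by
    have h1 : (x : ℂ) - c ≠ 0 := by
      rw [← neg_sub]; exact neg_ne_zero.mpr (sub_ofReal_ne_zero (by rw [hcim]; exact hb.ne') x)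
    have h2 : (x : ℂ) - c' ≠ 0 := by
      rw [← neg_sub]
      exact neg_ne_zero.mpr (sub_ofReal_ne_zero (by rw [hcim']; exact (neg_neg_of_pos hb).ne) x)
    have h3 := sub_ofReal_ne_zero hz.ne x
    have h4 : ((x : ℂ) - a) ^ 2 + b ^ 2 = (x - c) * (x - c') := by
      rw [hc, hc']; linear_combination (b : ℂ) ^ 2 * Complex.I_sq
    have h5 : c - c' = 2 * Complex.I * b := by rw [hc, hc']; ring
    have hπ : (Real.pi : ℂ) ≠ 0 := by exact_mod_cast Real.pi_ne_zero
    push_cast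
    rw [h4]
    field_simp
    linear_combination -h5
  rw [stieltjes, cauchyMeasure, integral_withDensity_eq_integral_toReal_smul (by fun_prop)
    (.of_forall fun _ => ENNReal.ofReal_lt_top)]
  have hnn (x : ℝ) : 0 ≤ 1 / Real.pi * b / ((x - a) ^ 2 + b ^ 2) := by positivity
  simp_rw [ENNReal.toReal_ofReal (hnn _), Complex.real_smul, hdens]
  rw [integral_const_mul, integral_sub (integrable_inv_mul_inv (by rw [hcim]; exact hb.ne') hz.ne)
    (integrable_inv_mul_inv (by rw [hcim']; exact (neg_neg_of_pos hb).ne) hz.ne),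
    integral_inv_mul_inv_of_im_neg (c := c') (by rw [hcim']; exact neg_neg_of_pos hb) hz, sub_zero]
  have h := integral_inv_mul_inv (c := c) (by rw [hcim]; exact hb) hz
  have hπ : (2 * Real.pi * Complex.I : ℂ) ≠ 0 := by
    simp [Real.pi_ne_zero]
  rw [inv_mul_eq_iff_eq_mul₀ hπ, ← h]
  field_simp

lemma stieltjes_cauchyOrDirac (a : ℝ) {b : ℝ} (hb : 0 ≤ b) {z : ℂ} (hz : z.im < 0) :
    stieltjes (cauchyOrDirac a b) z = (z - (a + Complex.I * b))⁻¹ := by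
  rw [cauchyOrDirac]
  split_ifs with h
  · simp [h, stieltjes_dirac]
  · exact stieltjes_cauchyMeasure a (lt_of_le_of_ne hb (Ne.symm h)) hz

/-- Integration over `{R ≤ |x|}` folds to integration over `(R, ∞)`. -/
lemma setIntegral_abs_ge {E : Type*} [NormedAddCommGroup E] [NormedSpace ℝ E] {f : ℝ → E} {R : ℝ}
    (hR : 0 < R) (hf : IntegrableOn f (Set.Ioi R)) (hf' : IntegrableOn (fun x => f (-x)) (Set.Ioi R)) :
    IntegrableOn f {x : ℝ | R ≤ |x|} ∧
      ∫ x in {x : ℝ | R ≤ |x|}, f x = (∫ x in Set.Ioi R, f x) + ∫ x in Set.Ioi R, f (-x) := by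
  have hS : {x : ℝ | R ≤ |x|} = Set.Ici R ∪ Set.Iic (-R) := by
    ext x
    simp [le_abs, le_neg]
  have hd : Disjoint (Set.Ici R) (Set.Iic (-R)) := by
    rw [Set.disjoint_left]
    intro x h1 h2
    simp only [Set.mem_Ici, Set.mem_Iic] at h1 h2
    linarith
  have i1 : IntegrableOn f (Set.Ici R) := (integrableOn_Ici_iff_integrableOn_Ioi).mpr hf
  have i2 : IntegrableOn f (Set.Iic (-R)) := by
    have h := (integrableOn_Ici_iff_integrableOn_Ioi).mpr hf'
    rw [← integrable_indicator_iff measurableSet_Ici] at h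
    rw [← integrable_indicator_iff measurableSet_Iic]
    refine h.comp_neg.congr (.of_forall fun x => ?_)
    simp [Set.indicator, le_neg]
  refine ⟨hS ▸ i1.union i2, ?_⟩
  rw [hS, setIntegral_union hd measurableSet_Iic i1 i2, integral_Ici_eq_integral_Ioi,
    integral_comp_neg_Ioi]

lemma integrableOn_Ioi_inv_pow {R : ℝ} (hR : 0 < R) (k : ℕ) :
    IntegrableOn (fun x : ℝ => (x ^ (k + 2))⁻¹) (Set.Ioi R) ∧
      ∫ x in Set.Ioi R, (x ^ (k + 2))⁻¹ = (R ^ (k + 1))⁻¹ / (k + 1) := by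
  have hk : (-(k + 2 : ℕ) : ℝ) < -1 := by
    push_cast
    have : (0 : ℝ) ≤ k := k.cast_nonneg
    linarith
  have e : Set.EqOn (fun x : ℝ => x ^ (-(k + 2 : ℕ) : ℝ)) (fun x : ℝ => (x ^ (k + 2))⁻¹)
      (Set.Ioi R) := fun x hx => by
    simp only
    rw [Real.rpow_neg (hR.trans hx).le, Real.rpow_natCast]
  refine ⟨(integrableOn_Ioi_rpow_of_lt hk hR).congr_fun e measurableSet_Ioi, ?_⟩
  rw [← setIntegral_congr_fun measurableSet_Ioi e, integral_Ioi_rpow_of_lt hk hR]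
  have h1 : (-(k + 2 : ℕ) : ℝ) + 1 = -(k + 1 : ℕ) := by push_cast; ring
  rw [h1, Real.rpow_neg hR.le, Real.rpow_natCast, neg_div_neg_eq]
  push_cast
  rfl

lemma setIntegral_abs_ge_inv_pow {R : ℝ} (hR : 0 < R) (k : ℕ) :
    IntegrableOn (fun x : ℝ => (x ^ (k + 2))⁻¹) {x : ℝ | R ≤ |x|} ∧
      ∫ x in {x : ℝ | R ≤ |x|}, (x ^ (k + 2))⁻¹ =
        (1 + (-1) ^ k) * ((R ^ (k + 1))⁻¹ / (k + 1)) := by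
  obtain ⟨h1, h2⟩ := integrableOn_Ioi_inv_pow hR k
  have e (x : ℝ) : ((-x) ^ (k + 2))⁻¹ = (-1) ^ k * (x ^ (k + 2))⁻¹ := by
    rw [neg_pow, mul_inv, pow_add (-1 : ℝ), mul_inv, ← inv_pow (-1 : ℝ)]
    norm_num
  obtain ⟨h3, h4⟩ := setIntegral_abs_ge hR h1 (by simp_rw [e]; exact h1.const_mul _)
  refine ⟨h3, h4.trans ?_⟩
  simp_rw [e]
  rw [integral_const_mul, h2]
  ring

lemma setIntegral_abs_ge_abs_inv_pow {R : ℝ} (hR : 0 < R) (k : ℕ) :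
    IntegrableOn (fun x : ℝ => (|x| ^ (k + 2))⁻¹) {x : ℝ | R ≤ |x|} ∧
      ∫ x in {x : ℝ | R ≤ |x|}, (|x| ^ (k + 2))⁻¹ = 2 * ((R ^ (k + 1))⁻¹ / (k + 1)) := by
  obtain ⟨h1, h2⟩ := integrableOn_Ioi_inv_pow hR k
  have e : Set.EqOn (fun x : ℝ => (x ^ (k + 2))⁻¹) (fun x : ℝ => (|x| ^ (k + 2))⁻¹)
      (Set.Ioi R) := fun x hx => by
    simp only
    rw [abs_of_pos (hR.trans hx)]
  have h1' := h1.congr_fun e measurableSet_Ioi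
  rw [setIntegral_congr_fun measurableSet_Ioi e] at h2
  obtain ⟨h3, h4⟩ := setIntegral_abs_ge hR h1' (by simpa using h1')
  refine ⟨h3, h4.trans ?_⟩
  simp_rw [abs_neg]
  rw [h2]
  ring

lemma measurableSet_abs_ge (R : ℝ) : MeasurableSet {x : ℝ | R ≤ |x|} :=
  measurableSet_le measurable_const measurable_id.abs

lemma natCast_mul_im_ne_zero {N : ℕ} (hN : 1 ≤ N) {z : ℂ} (hz : z.im ≠ 0) :
    ((N : ℂ) * z).im ≠ 0 := by
  have : N ≠ 0 := by omega
  simpa [this] using hz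

lemma norm_div_sub_ofReal_le {z : ℂ} (hz : z.im ≠ 0) (N : ℕ) (x : ℝ) :
    ‖N * z * (N * z - x)⁻¹‖ ≤ ‖z‖ * |z.im|⁻¹ := by
  rcases Nat.eq_zero_or_pos N with rfl | hN
  · simp only [Nat.cast_zero, zero_mul, norm_zero]
    positivity
  have hN' : (0 : ℝ) < N := by exact_mod_cast hN
  have him : ((N : ℂ) * z).im = N * z.im := by simp
  have h := norm_inv_sub_ofReal_le (z := N * z) (by rw [him]; exact mul_ne_zero hN'.ne' hz) x
  rw [him, abs_mul, abs_of_pos hN', mul_inv] at h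
  rw [norm_mul, norm_mul, Complex.norm_natCast]
  calc _ ≤ (N : ℝ) * ‖z‖ * ((N : ℝ)⁻¹ * |z.im|⁻¹) := by gcongr
    _ = _ := by field_simp

lemma tendsto_div_sub_ofReal {z : ℂ} (hz : z.im ≠ 0) (x : ℝ) :
    Tendsto (fun N : ℕ => N * z * (N * z - x)⁻¹) atTop (𝓝 1) := by
  have hz0 : z ≠ 0 := fun h => hz (by simp [h])
  have h1 : Tendsto (fun N : ℕ => z * (z - x * (N : ℂ)⁻¹)⁻¹) atTop (𝓝 (z * (z - x * 0)⁻¹)) :=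
    (((tendsto_inv_atTop_nhds_zero_nat (𝕜 := ℂ)).const_mul (x : ℂ)).const_sub z |>.inv₀
      (by simpa using hz0)).const_mul z
  rw [mul_zero, sub_zero, mul_inv_cancel₀ hz0] at h1
  refine h1.congr' ?_
  filter_upwards [eventually_ge_atTop 1] with N hN
  have hN' : (N : ℂ) ≠ 0 := by exact_mod_cast (show N ≠ 0 by omega)
  have e : (N : ℂ) * z - x = N * (z - x * (N : ℂ)⁻¹) := by field_simp
  rw [e, mul_inv]
  field_simp

/-- A dominated convergence statement for `x ↦ w / (w - x)` as `w` goes to infinity along a ray. -/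
lemma tendsto_integral_mul_div_sub (m : Measure ℝ) {z : ℂ} (hz : z.im ≠ 0) {g : ℝ → ℂ}
    (hg : Integrable g m) :
    Tendsto (fun N : ℕ => ∫ x, g x * (N * z * (N * z - x)⁻¹) ∂m) atTop (𝓝 (∫ x, g x ∂m)) := by
  refine tendsto_integral_of_dominated_convergence (fun x => ‖g x‖ * (‖z‖ * |z.im|⁻¹))
    (fun N => hg.aestronglyMeasurable.mul (by fun_prop)) (hg.norm.mul_const _)
    (fun N => .of_forall fun x => ?_) (.of_forall fun x => ?_)
  · rw [norm_mul]
    gcongr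
    exact norm_div_sub_ofReal_le hz N x
  · simpa using (tendsto_div_sub_ofReal hz x).const_mul (g x)

lemma norm_mul_div_sub_ofReal_le {w : ℂ} (hw : w.im ≠ 0) (x : ℝ) :
    ‖x * (w * (w - x)⁻¹)‖ ≤ ‖w‖ * (1 + ‖w‖ * |w.im|⁻¹) := by
  have e : x * (w * (w - x)⁻¹) = w * (w * (w - x)⁻¹ - 1) := by
    have := sub_ofReal_ne_zero hw x
    field_simp
    ring
  have h := norm_div_sub_ofReal_le hw 1 x
  simp only [Nat.cast_one, one_mul] at h
  rw [e, norm_mul]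
  gcongr
  refine (norm_sub_le _ _).trans ?_
  rw [norm_one]
  linarith

lemma integrable_mul_div_sub_ofReal (m : Measure ℝ) [IsFiniteMeasure m] {w : ℂ} (hw : w.im ≠ 0) :
    Integrable (fun x : ℝ => x * (w * (w - x)⁻¹)) m :=
  .of_bound (by fun_prop) _ (.of_forall (norm_mul_div_sub_ofReal_le hw))

/-- The second-order term of the Stieltjes transform at infinity. -/
lemma stieltjes_mul_sub_one (m : Measure ℝ) [IsProbabilityMeasure m] {w : ℂ} (hw : w.im ≠ 0) :
    w * (w * stieltjes m w - 1) = ∫ x : ℝ, x * (w * (w - x)⁻¹) ∂m := by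
  have h1 : w * stieltjes m w - 1 = ∫ x : ℝ, (w * (w - x)⁻¹ - 1) ∂m := by
    rw [integral_sub ((integrable_inv_sub_ofReal m hw).const_mul w) (integrable_const _),
      integral_const_mul, stieltjes]
    simp
  rw [h1, ← integral_const_mul]
  refine integral_congr_ae (.of_forall fun x => ?_)
  have := sub_ofReal_ne_zero hw x
  simp only
  field_simp
  ring

lemma integrableOn_div_sub_mul {w : ℂ} (hw : w.im ≠ 0) {R : ℝ} (hR : 0 < R) :
    IntegrableOn (fun x : ℝ => w * ((w - x) * x)⁻¹) {x : ℝ | R ≤ |x|} := by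
  refine ((setIntegral_abs_ge_abs_inv_pow hR 0).1.const_mul
    (‖w‖ * (1 + ‖w‖ * |w.im|⁻¹))).mono' (by fun_prop) ?_
  filter_upwards [ae_restrict_mem (measurableSet_abs_ge R)] with x hx
  have hx0 : 0 < |x| := hR.trans_le hx
  have hxc : (x : ℂ) ≠ 0 := by exact_mod_cast abs_pos.mp hx0
  have e : w * ((w - x) * x)⁻¹ = x * (w * (w - x)⁻¹) * ((x ^ 2)⁻¹ : ℝ) := by
    push_cast
    rw [mul_inv]
    field_simp
  rw [e, norm_mul, Complex.norm_real, Real.norm_eq_abs, abs_inv, abs_pow]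
  gcongr
  exact norm_mul_div_sub_ofReal_le hw x

/-- The odd part of the resolvent integrates to zero off a symmetric interval; what remains is a
full-line integral minus a contribution that is negligible for large `w`. -/
lemma setIntegral_div_sub_mul {w : ℂ} (hw : w.im < 0) {R : ℝ} (hR : 0 < R) :
    ∫ x in {x : ℝ | R ≤ |x|}, w * ((w - x) * x)⁻¹ = Real.pi * Complex.I -
      ∫ x in {x : ℝ | R ≤ |x|}ᶜ, w * ((x + w) * (w - x))⁻¹ := by
  set S := {x : ℝ | R ≤ |x|} with hS
  have hSm : MeasurableSet S := measurableSet_abs_ge R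
  have hJ := integral_inv_mul_inv (c := -w) (by simpa) hw
  have hJi := integrable_inv_mul_inv (c := -w) (z := w) (by simpa using hw.ne) hw.ne
  simp only [sub_neg_eq_add] at hJ hJi
  have hT (x : ℝ) (hx : x ∈ S) : w * ((w - x) * x)⁻¹ + w * ((w - (-x : ℝ)) * (-x : ℝ))⁻¹ =
      2 * (w * ((x + w) * (w - x))⁻¹) := by
    have h0 : (x : ℂ) ≠ 0 := by
      rintro h
      have : x = 0 := by exact_mod_cast h
      simp [hS, this] at hx
      linarith
    have h1 := sub_ofReal_ne_zero hw.ne x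
    have h2 := sub_ofReal_ne_zero hw.ne (-x)
    have h3 : (x : ℂ) + w ≠ 0 := by convert h2 using 1; push_cast; ring
    push_cast at h2 ⊢
    field_simp
    ring
  have hsymm : ∫ x in S, w * ((w - (-x : ℝ)) * (-x : ℝ))⁻¹ = ∫ x in S, w * ((w - x) * x)⁻¹ := by
    rw [← integral_indicator hSm, ← integral_indicator hSm, ← integral_neg_eq_self]
    refine integral_congr_ae (.of_forall fun x => ?_)
    simp [Set.indicator, hS]
  have hint : IntegrableOn (fun x : ℝ => w * ((w - x) * x)⁻¹) S := integrableOn_div_sub_mul hw.ne hR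
  have hint' : IntegrableOn (fun x : ℝ => w * ((w - (-x : ℝ)) * (-x : ℝ))⁻¹) S := by
    rw [← integrable_indicator_iff hSm] at hint ⊢
    refine hint.comp_neg.congr (.of_forall fun x => ?_)
    simp [Set.indicator, hS]
  have hwJ : w * ∫ x : ℝ, ((x + w) * (w - x))⁻¹ = Real.pi * Complex.I := by
    linear_combination hJ / 2
  rw [← hwJ, ← integral_const_mul, eq_sub_iff_add_eq,
    ← integral_add_compl hSm (hJi.const_mul w)]
  congr 1
  have h2 : ∫ x in S, (w * ((w - x) * x)⁻¹ + w * ((w - (-x : ℝ)) * (-x : ℝ))⁻¹) =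
      ∫ x in S, 2 * (w * ((x + w) * (w - x))⁻¹) := setIntegral_congr_fun hSm hT
  rw [integral_add hint hint', hsymm, integral_const_mul (2 : ℂ)] at h2
  linear_combination h2 / 2

/-- For `w` going to infinity along a ray of the lower half-plane the truncated integral
converges to the half-residue at infinity. -/
lemma tendsto_setIntegral_div_sub_mul {z : ℂ} (hz : z.im < 0) {R : ℝ} (hR : 0 < R) :
    Tendsto (fun N : ℕ => ∫ x in {x : ℝ | R ≤ |x|}, (N * z) * ((N * z - x) * x)⁻¹) atTop
      (𝓝 (Real.pi * Complex.I)) := by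
  have hcompl : {x : ℝ | R ≤ |x|}ᶜ = Set.Ioo (-R) R := by
    ext x
    simp [abs_lt]
  have hvol : (volume : Measure ℝ).real (Set.Ioo (-R) R) = 2 * R := by
    rw [Real.volume_real_Ioo_of_le (by linarith)]; ring
  have hrem : Tendsto (fun N : ℕ => ∫ x in {x : ℝ | R ≤ |x|}ᶜ,
      (N * z) * ((x + N * z) * (N * z - x))⁻¹) atTop (𝓝 0) := by
    rw [hcompl]
    have hlim : Tendsto (fun N : ℕ => ‖z‖ * (|z.im|⁻¹ * |z.im|⁻¹) * (2 * R) * (N : ℝ)⁻¹) atTop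
        (𝓝 0) := by
      simpa using (tendsto_inv_atTop_nhds_zero_nat (𝕜 := ℝ)).const_mul
        (‖z‖ * (|z.im|⁻¹ * |z.im|⁻¹) * (2 * R))
    refine squeeze_zero_norm' ?_ hlim
    filter_upwards [eventually_ge_atTop 1] with N hN
    have hN' : (0 : ℝ) < N := by exact_mod_cast hN
    have him : ((N : ℂ) * z).im = N * z.im := by simp
    have him0 : ((N : ℂ) * z).im ≠ 0 := by rw [him]; exact mul_ne_zero hN'.ne' hz.ne
    have hb (x : ℝ) : ‖(N * z) * ((x + N * z) * (N * z - x))⁻¹‖ ≤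
        ‖z‖ * (|z.im|⁻¹ * |z.im|⁻¹) * (N : ℝ)⁻¹ := by
      have b1 := norm_inv_sub_ofReal_le him0 x
      have b2 := norm_inv_sub_ofReal_le him0 (-x)
      have e : (N : ℂ) * z - ((-x : ℝ) : ℂ) = x + N * z := by push_cast; ring
      rw [e] at b2
      rw [him, abs_mul, abs_of_pos hN', mul_inv] at b1 b2
      rw [mul_inv, norm_mul, norm_mul, norm_mul, Complex.norm_natCast]
      calc _ ≤ (N : ℝ) * ‖z‖ * (((N : ℝ)⁻¹ * |z.im|⁻¹) * ((N : ℝ)⁻¹ * |z.im|⁻¹)) := by gcongr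
        _ = _ := by field_simp
    have h := norm_setIntegral_le_of_norm_le_const (μ := volume) (s := Set.Ioo (-R) R)
      (by simp) (fun x _ => hb x)
    rw [hvol] at h
    exact h.trans (le_of_eq (by ring))
  have h := hrem.const_sub (Real.pi * Complex.I)
  rw [sub_zero] at h
  refine h.congr' ?_
  filter_upwards [eventually_ge_atTop 1] with N hN
  have hN' : (0 : ℝ) < N := by exact_mod_cast hN
  have him : ((N : ℂ) * z).im < 0 := by
    simpa using mul_neg_of_pos_of_neg hN' hz
  rw [setIntegral_div_sub_mul him hR]

section A2

variable {p : ℝ → ℝ} {a : ℕ → ℝ} {r R : ℝ}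

lemma A2.R_pos (h : A2 p a r R) : 0 < R := h.hr.trans h.hrR

lemma A2.measurable_density (h : A2 p a r R) :
    Measurable (fun x => if R ≤ |x| then p x else 0) := by
  refine measurable_of_tendsto_metrizable
    (f := fun N x => if R ≤ |x| then ∑ n ∈ Finset.range N, a n / x ^ n else 0)
    (fun N => Measurable.ite (measurableSet_abs_ge R) (by fun_prop) measurable_const) ?_
  rw [tendsto_pi_nhds]
  intro x
  by_cases hx : R ≤ |x|
  · simpa [hx] using (h.hsum x (h.hrR.trans_le hx)).tendsto_sum_nat
  · simp [hx]

lemma A2.integral_tailMeasure (h : A2 p a r R) (f : ℝ → ℂ) :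
    ∫ x, f x ∂(tailMeasure p R) = ∫ x in {x : ℝ | R ≤ |x|}, (p x : ℂ) * f x := by
  rw [tailMeasure, integral_withDensity_eq_integral_toReal_smul h.measurable_density.ennreal_ofReal
    (.of_forall fun _ => ENNReal.ofReal_lt_top), ← integral_indicator (measurableSet_abs_ge R)]
  refine integral_congr_ae (.of_forall fun x => ?_)
  by_cases hx : R ≤ |x|
  · simp [Set.indicator, hx, ENNReal.toReal_ofReal (h.hpos x hx)]
  · simp [Set.indicator, hx]

lemma A2.summable_coeff (h : A2 p a r R) (j : ℕ) :
    Summable (fun k => |a (k + 3)| / R ^ (k + j)) := by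
  have h1 := (summable_nat_add_iff 3).mpr (h.habs R (by rw [abs_of_pos h.R_pos]; exact h.hrR))
  rw [abs_of_pos h.R_pos] at h1
  refine (h1.mul_left (R ^ 3 / R ^ j)).congr fun k => ?_
  have := h.R_pos.ne'
  rw [pow_add, pow_add]
  field_simp

/-- Isolating the leading coefficient in the expansion of the density. -/
lemma A2.pC_eq (h : A2 p a r R) {z : ℂ} (hz : R ≤ ‖z‖) :
    pC a z = a 2 / z ^ 2 + ∑' k : ℕ, (a (k + 3) : ℂ) / z ^ (k + 3) := by
  have hs : Summable (fun n => (a n : ℂ) / z ^ n) := by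
    refine .of_norm ((h.habs ‖z‖ (by rw [abs_norm]; exact h.hrR.trans_le hz)).congr fun n => ?_)
    simp
  rw [pC, ← hs.sum_add_tsum_nat_add 3]
  simp [Finset.sum_range_succ, h.ha0, h.ha1]

lemma A2.ofReal_eq_pC (h : A2 p a r R) {x : ℝ} (hx : R ≤ |x|) : (p x : ℂ) = pC a x := by
  rw [pC, ← (h.hsum x (h.hrR.trans_le hx)).tsum_eq, Complex.ofReal_tsum]
  simp

/-- The remainder `x (p x - a₂/x²)`, as a series. -/
lemma A2.mul_self_eq (h : A2 p a r R) {x : ℝ} (hx : R ≤ |x|) :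
    (p x : ℂ) * x = a 2 * (x : ℂ)⁻¹ + ∑' k : ℕ, (a (k + 3) : ℂ) * ((x ^ (k + 2))⁻¹ : ℝ) := by
  have hx0 : (x : ℂ) ≠ 0 := by
    have := abs_pos.mp (h.R_pos.trans_le hx)
    exact_mod_cast this
  rw [h.ofReal_eq_pC hx, h.pC_eq (by simpa using hx), add_mul, ← tsum_mul_right]
  congr 1
  · field_simp
  · refine tsum_congr fun k => ?_
    push_cast
    rw [pow_succ _ (k + 2)]
    field_simp

lemma A2.norm_tsum_le (h : A2 p a r R) {x : ℝ} (hx : R ≤ |x|) :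
    ‖∑' k : ℕ, (a (k + 3) : ℂ) * ((x ^ (k + 2))⁻¹ : ℝ)‖ ≤
      (∑' k, |a (k + 3)| / R ^ (k + 0)) * (|x| ^ 2)⁻¹ := by
  have hx0 := h.R_pos.trans_le hx
  refine tsum_of_norm_bounded ((h.summable_coeff 0).hasSum.mul_right _) fun k => ?_
  rw [norm_mul, Complex.norm_real, Complex.norm_real, Real.norm_eq_abs, Real.norm_eq_abs, abs_inv,
    abs_pow, pow_add, mul_inv, add_zero, div_mul_eq_mul_div, mul_div_assoc, div_eq_inv_mul]
  have := h.R_pos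
  gcongr

lemma A2.integral_tsum (h : A2 p a r R) :
    ∫ x in {x : ℝ | R ≤ |x|}, ∑' k : ℕ, (a (k + 3) : ℂ) * ((x ^ (k + 2))⁻¹ : ℝ) =
      ∑' k : ℕ, (a (k + 3) : ℂ) * ((1 + (-1) ^ k) * ((R ^ (k + 1))⁻¹ / (k + 1)) : ℝ) := by
  rw [← integral_tsum_of_summable_integral_norm]
  · refine tsum_congr fun k => ?_
    rw [integral_const_mul, integral_complex_ofReal, (setIntegral_abs_ge_inv_pow h.R_pos k).2]
  · exact fun k => ((setIntegral_abs_ge_inv_pow h.R_pos k).1.ofReal).const_mul _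
  · simp only [norm_mul, Complex.norm_real, Real.norm_eq_abs, abs_inv, abs_pow,
      integral_const_mul, (setIntegral_abs_ge_abs_inv_pow h.R_pos _).2]
    refine .of_nonneg_of_le (fun k => ?_) (fun k => ?_) ((h.summable_coeff 1).mul_left 2)
    · have := h.R_pos
      positivity
    · have h1 : (R ^ (k + 1))⁻¹ / ((k : ℝ) + 1) ≤ (R ^ (k + 1))⁻¹ :=
        div_le_self (by have := h.R_pos; positivity) (by simp)
      have h2 := mul_le_mul_of_nonneg_left h1 (abs_nonneg (a (k + 3)))
      rw [div_eq_mul_inv |a (k + 3)|]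
      linarith

lemma integral_exp_neg_mul_I (k : ℕ) :
    ∫ θ in (0 : ℝ)..Real.pi, Complex.I * Complex.exp (-(k + 1) * Complex.I * θ) =
      (1 + (-1) ^ k) / (k + 1) := by
  have hk : (k : ℂ) + 1 ≠ 0 := Nat.cast_add_one_ne_zero k
  have hc : -((k : ℂ) + 1) * Complex.I ≠ 0 := mul_ne_zero (neg_ne_zero.mpr hk) Complex.I_ne_zero
  have e : Complex.exp (-(k + 1) * Complex.I * Real.pi) = (-1) ^ (k + 1) := by
    have : -((k : ℂ) + 1) * Complex.I * Real.pi = (k + 1 : ℕ) * (-(Real.pi * Complex.I)) := by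
      push_cast; ring
    rw [this, Complex.exp_nat_mul, Complex.exp_neg, Complex.exp_pi_mul_I]
    norm_num
  rw [intervalIntegral.integral_const_mul, integral_exp_mul_complex hc, e]
  simp only [Complex.ofReal_zero, mul_zero, Complex.exp_zero]
  have := Complex.I_ne_zero
  field_simp
  ring

/-- The contour integral in the complex first moment, evaluated term by term. -/
lemma A2.arcInt_eq (h : A2 p a r R) :
    arcInt 0 Real.pi R (fun z => z * pC a z) = a 2 * (Real.pi * Complex.I) +
      ∑' k : ℕ, (a (k + 3) : ℂ) * ((1 + (-1) ^ k) * ((R ^ (k + 1))⁻¹ / (k + 1)) : ℝ) := by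
  have hR := h.R_pos
  have hRC : (R : ℂ) ≠ 0 := by exact_mod_cast hR.ne'
  set F : ℕ → ℝ → ℂ := fun k θ => (a (k + 3) : ℂ) * ((R : ℂ) ^ (k + 1))⁻¹ *
    (Complex.I * Complex.exp (-(k + 1) * Complex.I * θ)) with hF
  have hFn (k : ℕ) (θ : ℝ) : ‖F k θ‖ = |a (k + 3)| / R ^ (k + 1) := by
    have : -((k : ℂ) + 1) * Complex.I * θ = ((-(k + 1) * θ : ℝ) : ℂ) * Complex.I := by
      push_cast; ring
    simp only [hF, this, norm_mul, Complex.norm_exp_ofReal_mul_I]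
    simp [abs_of_pos hR, div_eq_mul_inv]
  have hFs (θ : ℝ) : Summable (fun k => F k θ) :=
    .of_norm ((h.summable_coeff 1).congr fun k => (hFn k θ).symm)
  have hint : HasSum (fun k => ∫ θ in (0 : ℝ)..Real.pi, F k θ)
      (∫ θ in (0 : ℝ)..Real.pi, ∑' k, F k θ) := by
    refine intervalIntegral.hasSum_integral_of_dominated_convergence
      (fun k _ => |a (k + 3)| / R ^ (k + 1))
      (fun k => Continuous.aestronglyMeasurable (by fun_prop))
      (fun k => .of_forall fun θ _ => (hFn k θ).le)
      (.of_forall fun _ _ => h.summable_coeff 1) intervalIntegrable_const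
      (.of_forall fun θ _ => (hFs θ).hasSum)
  have hcont : Continuous fun θ => ∑' k, F k θ :=
    continuous_tsum (fun k => by fun_prop) (h.summable_coeff 1) fun k θ => (hFn k θ).le
  have hpt (θ : ℝ) : (Complex.I * R * Complex.exp (θ * Complex.I)) *
      ((R * Complex.exp (θ * Complex.I)) * pC a (R * Complex.exp (θ * Complex.I))) =
      a 2 * Complex.I + ∑' k, F k θ := by
    have hn : ‖(R : ℂ) * Complex.exp (θ * Complex.I)‖ = R := by
      rw [norm_mul, Complex.norm_exp_ofReal_mul_I, mul_one, Complex.norm_real,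
        Real.norm_of_nonneg hR.le]
    have he := Complex.exp_ne_zero (θ * Complex.I)
    rw [h.pC_eq hn.ge, mul_add, mul_add, ← tsum_mul_left, ← tsum_mul_left]
    congr 1
    · field_simp
    · refine tsum_congr fun k => ?_
      have e : Complex.exp (-(k + 1) * Complex.I * θ) =
          (Complex.exp (θ * Complex.I) ^ (k + 1))⁻¹ := by
        rw [← Complex.exp_nat_mul, ← Complex.exp_neg]
        congr 1
        push_cast
        ring
      simp only [hF, e]
      rw [mul_pow, pow_add _ k 3, pow_add _ k 3, pow_succ, pow_succ]
      field_simp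
      ring
  rw [arcInt]
  simp_rw [hpt]
  rw [intervalIntegral.integral_add intervalIntegrable_const (hcont.intervalIntegrable _ _),
    intervalIntegral.integral_const, ← hint.tsum_eq]
  congr 1
  · simp
    ring
  · refine tsum_congr fun k => ?_
    simp only [hF]
    rw [intervalIntegral.integral_const_mul, integral_exp_neg_mul_I]
    push_cast
    ring

lemma A2.integrable_tsum (h : A2 p a r R) :
    IntegrableOn (fun x : ℝ => ∑' k : ℕ, (a (k + 3) : ℂ) * ((x ^ (k + 2))⁻¹ : ℝ))
      {x : ℝ | R ≤ |x|} := by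
  have hm : AEStronglyMeasurable
      (fun x : ℝ => ∑' k : ℕ, (a (k + 3) : ℂ) * ((x ^ (k + 2))⁻¹ : ℝ))
      (volume.restrict {x : ℝ | R ≤ |x|}) := by
    refine aestronglyMeasurable_of_tendsto_ae atTop
      (f := fun N x => ∑ k ∈ Finset.range N, (a (k + 3) : ℂ) * ((x ^ (k + 2))⁻¹ : ℝ))
      (fun N => by fun_prop) ?_
    filter_upwards [ae_restrict_mem (measurableSet_abs_ge R)] with x hx
    refine (Summable.of_norm (.of_nonneg_of_le (fun _ => norm_nonneg _) (fun k => ?_)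
      ((h.summable_coeff 2)))).hasSum.tendsto_sum_nat
    have := h.R_pos
    rw [norm_mul, Complex.norm_real, Complex.norm_real, Real.norm_eq_abs, Real.norm_eq_abs,
      abs_inv, abs_pow, div_eq_mul_inv]
    have hx' : R ≤ |x| := hx
    gcongr
  refine ((setIntegral_abs_ge_abs_inv_pow h.R_pos 0).1.const_mul
    (∑' k, |a (k + 3)| / R ^ (k + 0))).mono' hm ?_
  filter_upwards [ae_restrict_mem (measurableSet_abs_ge R)] with x hx
  exact h.norm_tsum_le hx

/-- The complex first moment of the tail measure as a limit of truncated first moments. -/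
lemma A2.tendsto_integral_tailMeasure (h : A2 p a r R) {z : ℂ} (hz : z.im < 0) :
    Tendsto (fun N : ℕ => ∫ x : ℝ, x * (N * z * (N * z - x)⁻¹) ∂(tailMeasure p R)) atTop
      (𝓝 (arcInt 0 Real.pi R (fun z => z * pC a z))) := by
  rw [h.arcInt_eq, ← h.integral_tsum]
  refine (((tendsto_setIntegral_div_sub_mul hz h.R_pos).const_mul (a 2 : ℂ)).add
    (tendsto_integral_mul_div_sub _ hz.ne h.integrable_tsum)).congr' ?_
  filter_upwards [eventually_ge_atTop 1] with N hN
  have him := natCast_mul_im_ne_zero hN hz.ne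
  rw [h.integral_tailMeasure, ← integral_const_mul, ← integral_add]
  · refine setIntegral_congr_fun (measurableSet_abs_ge R) fun x hx => ?_
    have e := h.mul_self_eq hx
    simp only [mul_inv]
    linear_combination -(N * z * (N * z - x)⁻¹) * e
  · exact (integrableOn_div_sub_mul him h.R_pos).const_mul _
  · exact h.integrable_tsum.mul_bdd (c := ‖z‖ * |z.im|⁻¹) (by fun_prop)
      (.of_forall (norm_div_sub_ofReal_le hz.ne N))

end A2

/-- The reciprocal Stieltjes transform along a ray, given the second-order behaviour of the
Stieltjes transform. -/
lemma tendsto_inv_stieltjes_sub (μ : Measure ℝ) [IsProbabilityMeasure μ] {z l : ℂ} (hz : z.im ≠ 0)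
    (hl : Tendsto (fun N : ℕ => ∫ x : ℝ, x * (N * z * (N * z - x)⁻¹) ∂μ) atTop (𝓝 l)) :
    Tendsto (fun N : ℕ => (stieltjes μ (N * z))⁻¹ - ((N : ℂ) - 1) * z) atTop (𝓝 (z - l)) := by
  have hz0 : z ≠ 0 := fun h => hz (by simp [h])
  set E : ℕ → ℂ := fun N => ∫ x : ℝ, x * (N * z * (N * z - x)⁻¹) ∂μ
  have hu : Tendsto (fun N : ℕ => 1 + E N * ((N : ℂ)⁻¹ * z⁻¹)) atTop (𝓝 1) := by
    simpa using (hl.mul ((tendsto_inv_atTop_nhds_zero_nat (𝕜 := ℂ)).mul_const z⁻¹)).const_add 1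
  have hlim := (hl.mul (hu.inv₀ one_ne_zero)).const_sub z
  rw [inv_one, mul_one] at hlim
  refine hlim.congr' ?_
  filter_upwards [eventually_ge_atTop 1, hu.eventually_ne one_ne_zero] with N hN hne
  have hN' : (N : ℂ) ≠ 0 := by exact_mod_cast (show N ≠ 0 by omega)
  have him := natCast_mul_im_ne_zero hN hz
  have hG : stieltjes μ (N * z) = (N * z)⁻¹ * (1 + E N * ((N : ℂ)⁻¹ * z⁻¹)) := by
    have hE : E N = N * z * (N * z * stieltjes μ (N * z) - 1) := (stieltjes_mul_sub_one μ him).symm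
    rw [hE]
    field_simp
    ring
  rw [hG, mul_inv, inv_inv]
  set u := 1 + E N * ((N : ℂ)⁻¹ * z⁻¹) with hu'
  have hEu : E N = N * z * (u - 1) := by
    rw [hu']
    field_simp
    ring
  rw [hEu]
  field_simp
  ring

/-- Theorem 3.1 (Boolean case): for `μ = ν + λ ∈ P₂` with `m₁(μ) = a + bi`, the Boolean
convolution powers `μ_N^B = (D_{1/N} μ)^{⊎N}`, characterized by
`F_{μ_N^B}(z) = F_μ(Nz) - (N-1)z`, converge weakly to `μ_{a,b}`; in particular
`F_μ(Nz) - (N-1)z → z - m₁(μ)` on the lower half-plane. -/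
theorem clt_cauchy_boolean
    (ν : Measure ℝ) [IsFiniteMeasure ν]
    (hν2 : Integrable (fun x : ℝ => x ^ 2) ν)
    (p : ℝ → ℝ) (aseq : ℕ → ℝ) (r R : ℝ) (hA2 : A2 p aseq r R)
    (μ : Measure ℝ) (hμ : μ = ν + tailMeasure p R) (hprob : IsProbabilityMeasure μ)
    (a b : ℝ) (hb : 0 ≤ b)
    (hm1 : (∫ x, x ∂ν : ℝ) + arcInt 0 Real.pi R (fun z => z * pC aseq z) =
      a + Complex.I * b)
    -- `μB N` is the Boolean convolution power `(D_{1/N} μ)^{⊎ N}`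
    (μB : ℕ → Measure ℝ) (hμBprob : ∀ N, IsProbabilityMeasure (μB N))
    (hμB : ∀ N : ℕ, 1 ≤ N → ∀ z : ℂ, z.im < 0 →
      (stieltjes (μB N) z)⁻¹ = (stieltjes μ (N * z))⁻¹ - ((N : ℂ) - 1) * z) :
    (∀ z : ℂ, z.im < 0 →
      Filter.Tendsto (fun N : ℕ => (stieltjes μ (N * z))⁻¹ - ((N : ℂ) - 1) * z)
        Filter.atTop (nhds (z - (a + Complex.I * b)))) ∧
    (∀ f : BoundedContinuousFunction ℝ ℝ,
      Filter.Tendsto (fun N : ℕ => ∫ x, f x ∂(μB N)) Filter.atTop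
        (nhds (∫ x, f x ∂(cauchyOrDirac a b)))) := by
  subst hμ
  have hνi : Integrable (fun x : ℝ => (x : ℂ)) ν := by
    refine Integrable.ofReal ((memLp_one_iff_integrable).mp ?_)
    exact ((memLp_two_iff_integrable_sq (by fun_prop)).mpr hν2).mono_exponent (by norm_num)
  have : IsFiniteMeasure (tailMeasure p R) :=
    isFiniteMeasure_of_le (ν + tailMeasure p R) (Measure.le_add_left le_rfl)
  have hF (z : ℂ) (hz : z.im < 0) :
      Tendsto (fun N : ℕ => (stieltjes (ν + tailMeasure p R) (N * z))⁻¹ - ((N : ℂ) - 1) * z)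
        atTop (𝓝 (z - (a + Complex.I * b))) := by
    refine tendsto_inv_stieltjes_sub _ hz.ne ?_
    rw [← hm1, ← integral_complex_ofReal]
    refine ((tendsto_integral_mul_div_sub ν hz.ne hνi).add
      (hA2.tendsto_integral_tailMeasure hz)).congr' ?_
    filter_upwards [eventually_ge_atTop 1] with N hN
    have him := natCast_mul_im_ne_zero hN hz.ne
    exact (integral_add_measure (integrable_mul_div_sub_ofReal ν him)
      (integrable_mul_div_sub_ofReal (tailMeasure p R) him)).symm
  refine ⟨hF, ?_⟩
  have hprobC : IsProbabilityMeasure (cauchyOrDirac a b) := by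
    rw [cauchyOrDirac_eq a b hb]
    infer_instance
  refine ProbabilityMeasure.tendsto_iff_forall_integral_tendsto.mp
    (tendsto_of_tendsto_stieltjes (μs := fun N => ⟨μB N, hμBprob N⟩)
      (μ := ⟨cauchyOrDirac a b, hprobC⟩) fun z hz => ?_)
  simp only [ProbabilityMeasure.coe_mk]
  rw [stieltjes_cauchyOrDirac a hb hz]
  have hne : z - (a + Complex.I * b) ≠ 0 := fun h => by
    have := congrArg Complex.im h
    simp at this
    linarith
  refine ((hF z hz).inv₀ hne).congr' ?_
  filter_upwards [eventually_ge_atTop 1] with N hN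
  rw [← hμB N hN z hz, inv_inv]
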